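/- The HCT space has dimension 12: let a₁, a₂, a₃ ∈ ℝ² be affinely independent, T := convexHull ℝ {a₁, a₂, a₃}, G := (a₁ + a₂ + a₃)/3, and Tᵢ := convexHull ℝ {G, a_{i+1}, a_{i+2}} (indices modulo 3). Then the real vector space HCT(T) of functions f : T → ℝ that are C¹ on T and whose restriction to each subtriangle Tᵢ agrees with a bivariate polynomial of total degree at most 3 is finite-dimensional of dimension exactly 12. -/

import Mathlib

/-- `f` agrees, on the set `S ⊆ ℝ²`, with (the evaluation of) a bivariate polynomial of total
degree at most 3. -/
def AgreesWithCubicOn (S : Set (EuclideanSpace ℝ (Fin 2)))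
    (f : EuclideanSpace ℝ (Fin 2) → ℝ) : Prop :=
  ∃ p : MvPolynomial (Fin 2) ℝ, p.totalDegree ≤ 3 ∧
    ∀ x ∈ S, f x = MvPolynomial.eval (fun i : Fin 2 => x i) p

/-- The bivariate cubic with coefficient vector `c`, in the monomial basis ordered by degree. -/
def cubic (c : Fin 10 → ℝ) (u v : ℝ) : ℝ :=
  c 0 + c 1 * u + c 2 * v + c 3 * u ^ 2 + c 4 * (u * v) + c 5 * v ^ 2
    + c 6 * u ^ 3 + c 7 * (u ^ 2 * v) + c 8 * (u * v ^ 2) + c 9 * v ^ 3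

/-- The partial derivative of `cubic c` in its first variable. -/
def cubicDerivU (c : Fin 10 → ℝ) (u v : ℝ) : ℝ :=
  c 1 + 2 * c 3 * u + c 4 * v + 3 * c 6 * u ^ 2 + 2 * c 7 * (u * v) + c 8 * v ^ 2

/-- The partial derivative of `cubic c` in its second variable. -/
def cubicDerivV (c : Fin 10 → ℝ) (u v : ℝ) : ℝ :=
  c 2 + c 4 * u + 2 * c 5 * v + c 7 * u ^ 2 + 2 * c 8 * (u * v) + 3 * c 9 * v ^ 2

/-- Coefficients, on the sector `0 ≤ u`, `0 ≤ v`, of the spline with parameters `w`. -/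
def hctCoeff₃ (w : Fin 12 → ℝ) : Fin 10 → ℝ :=
  ![w 0, w 1, w 2, w 3, w 4, w 5, w 6, w 7, w 8, w 9]

/-- Coefficients, on the sector `u ≤ 0`, `u ≤ v`, of the spline with parameters `w`. -/
def hctCoeff₁ (w : Fin 12 → ℝ) : Fin 10 → ℝ :=
  ![w 0, w 1, w 2, w 3, w 4, w 5, w 6 + w 10, w 7 - 2 * w 10 + w 11, w 8, w 9]

/-- Coefficients, on the sector `v ≤ 0`, `v ≤ u`, of the spline with parameters `w`. -/
def hctCoeff₂ (w : Fin 12 → ℝ) : Fin 10 → ℝ :=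
  ![w 0, w 1, w 2, w 3, w 4, w 5, w 6, w 7, w 8 - w 10 + 2 * w 11, w 9 - w 11]

theorem exists_hctCoeff_of_matching {c₁ c₂ c₃ : Fin 10 → ℝ}
    (h₃₂ : ∀ t ∈ Set.Icc (0 : ℝ) 1, cubic c₃ t 0 = cubic c₂ t 0 ∧
      cubicDerivV c₃ t 0 = cubicDerivV c₂ t 0)
    (h₃₁ : ∀ t ∈ Set.Icc (0 : ℝ) 1, cubic c₃ 0 t = cubic c₁ 0 t ∧
      cubicDerivU c₃ 0 t = cubicDerivU c₁ 0 t)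
    (h₁₂ : ∀ t ∈ Set.Icc (0 : ℝ) 1, cubic c₁ (-t) (-t) = cubic c₂ (-t) (-t) ∧
      cubicDerivU c₁ (-t) (-t) = cubicDerivU c₂ (-t) (-t)) :
    ∃ w, c₁ = hctCoeff₁ w ∧ c₂ = hctCoeff₂ w ∧ c₃ = hctCoeff₃ w := by
  have m : (0 : ℝ) ∈ Set.Icc (0 : ℝ) 1 ∧ (1 / 4 : ℝ) ∈ Set.Icc (0 : ℝ) 1 ∧
      (1 / 2 : ℝ) ∈ Set.Icc (0 : ℝ) 1 ∧ (1 : ℝ) ∈ Set.Icc (0 : ℝ) 1 := by norm_num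
  obtain ⟨m₀, m₁, m₂, m₃⟩ := m
  have a : (c₂ 0 = c₃ 0 ∧ c₂ 1 = c₃ 1 ∧ c₂ 3 = c₃ 3 ∧ c₂ 6 = c₃ 6) ∧
      c₂ 2 = c₃ 2 ∧ c₂ 4 = c₃ 4 ∧ c₂ 7 = c₃ 7 := by
    have a₀ := h₃₂ _ m₀
    have a₁ := h₃₂ _ m₁
    have a₂ := h₃₂ _ m₂
    have a₃ := h₃₂ _ m₃
    norm_num [cubic, cubicDerivV] at a₀ a₁ a₂ a₃
    refine ⟨⟨?_, ?_, ?_, ?_⟩, ?_, ?_, ?_⟩ <;> linarith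
  have b : (c₁ 0 = c₃ 0 ∧ c₁ 2 = c₃ 2 ∧ c₁ 5 = c₃ 5 ∧ c₁ 9 = c₃ 9) ∧
      c₁ 1 = c₃ 1 ∧ c₁ 4 = c₃ 4 ∧ c₁ 8 = c₃ 8 := by
    have b₀ := h₃₁ _ m₀
    have b₁ := h₃₁ _ m₁
    have b₂ := h₃₁ _ m₂
    have b₃ := h₃₁ _ m₃
    norm_num [cubic, cubicDerivU] at b₀ b₁ b₂ b₃
    refine ⟨⟨?_, ?_, ?_, ?_⟩, ?_, ?_, ?_⟩ <;> linarith
  obtain ⟨⟨a0, a1, a3, a6⟩, a2, a4, a7⟩ := a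
  obtain ⟨⟨b0, b2, b5, b9⟩, b1, b4, b8⟩ := b
  have d : c₁ 3 = c₃ 3 ∧ c₂ 5 = c₃ 5 ∧ c₁ 7 = c₃ 7 - 2 * (c₁ 6 - c₃ 6) + (c₃ 9 - c₂ 9) ∧
      c₂ 8 = c₃ 8 - (c₁ 6 - c₃ 6) + 2 * (c₃ 9 - c₂ 9) := by
    have d₁ := h₁₂ _ m₁
    have d₂ := h₁₂ _ m₂
    have d₃ := h₁₂ _ m₃
    norm_num [cubic, cubicDerivU] at d₁ d₂ d₃
    refine ⟨?_, ?_, ?_, ?_⟩ <;> linarith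
  obtain ⟨d3, d5, d7, d8⟩ := d
  clear h₃₂ h₃₁ h₁₂
  refine ⟨![c₃ 0, c₃ 1, c₃ 2, c₃ 3, c₃ 4, c₃ 5, c₃ 6, c₃ 7, c₃ 8, c₃ 9,
    c₁ 6 - c₃ 6, c₃ 9 - c₂ 9], ?_, ?_, ?_⟩ <;> ext i <;> fin_cases i <;>
    simp [hctCoeff₁, hctCoeff₂, hctCoeff₃, *]

theorem eq_zero_of_hctCoeff_vanishing {w : Fin 12 → ℝ}
    (h₃ : ∀ u v : ℝ, 0 ≤ u → 0 ≤ v → u + v ≤ 1 → cubic (hctCoeff₃ w) u v = 0)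
    (h₁ : ∀ u v : ℝ, u ≤ 0 → u ≤ v → v - 2 * u ≤ 1 → cubic (hctCoeff₁ w) u v = 0) :
    w = 0 := by
  have h00 := h₃ 0 0
  have h10 := h₃ (1 / 3) 0
  have h20 := h₃ (2 / 3) 0
  have h30 := h₃ 1 0
  have h01 := h₃ 0 (1 / 3)
  have h02 := h₃ 0 (2 / 3)
  have h03 := h₃ 0 1
  have h11 := h₃ (1 / 3) (1 / 3)
  have h21 := h₃ (2 / 3) (1 / 3)
  have h12 := h₃ (1 / 3) (2 / 3)
  have k₁ := h₁ (-1) (-1)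
  have k₂ := h₁ (-1 / 2) 0
  simp only [cubic, hctCoeff₃, hctCoeff₁, Matrix.cons_val]
    at h00 h10 h20 h30 h01 h02 h03 h11 h21 h12 k₁ k₂
  norm_num at h00 h10 h20 h30 h01 h02 h03 h11 h21 h12 k₁ k₂
  ext i
  fin_cases i <;> simp [Fin.isValue] <;> linarith

/-- The piecewise cubic with parameters `w`. -/
noncomputable def hctFun (w : Fin 12 → ℝ) (u v : ℝ) : ℝ :=
  if 0 ≤ u ∧ 0 ≤ v then cubic (hctCoeff₃ w) u v
  else if u ≤ v then cubic (hctCoeff₁ w) u v else cubic (hctCoeff₂ w) u v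

theorem hctFun_add (w w' : Fin 12 → ℝ) (u v : ℝ) :
    hctFun (w + w') u v = hctFun w u v + hctFun w' u v := by
  simp only [hctFun]
  split_ifs <;> simp [cubic, hctCoeff₁, hctCoeff₂, hctCoeff₃] <;> ring

theorem hctFun_smul (r : ℝ) (w : Fin 12 → ℝ) (u v : ℝ) :
    hctFun (r • w) u v = r * hctFun w u v := by
  simp only [hctFun]
  split_ifs <;> simp [cubic, hctCoeff₁, hctCoeff₂, hctCoeff₃] <;> ring

/-- The sectors of the plane cut out by the rays through `(1, 0)`, `(0, 1)` and `(-1, -1)`. -/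
def hctSector : Fin 3 → Set (ℝ × ℝ) :=
  ![{p | p.1 ≤ 0 ∧ p.1 ≤ p.2}, {p | p.2 ≤ 0 ∧ p.2 ≤ p.1}, {p | 0 ≤ p.1 ∧ 0 ≤ p.2}]

/-- The coefficients of the piecewise cubic with parameters `w` on each sector. -/
def hctCoeff : Fin 3 → (Fin 12 → ℝ) → Fin 10 → ℝ := ![hctCoeff₁, hctCoeff₂, hctCoeff₃]

theorem isClosed_hctSector (i : Fin 3) : IsClosed (hctSector i) := by
  fin_cases i
  · exact (isClosed_le continuous_fst continuous_const).inter
      (isClosed_le continuous_fst continuous_snd)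
  · exact (isClosed_le continuous_snd continuous_const).inter
      (isClosed_le continuous_snd continuous_fst)
  · exact (isClosed_le continuous_const continuous_fst).inter
      (isClosed_le continuous_const continuous_snd)

theorem exists_mem_hctSector (p : ℝ × ℝ) : ∃ i, p ∈ hctSector i := by
  by_contra! h
  have h₁ := h 0
  have h₂ := h 1
  have h₃ := h 2
  simp only [hctSector, Matrix.cons_val, Set.mem_ofPred_eq] at h₁ h₂ h₃
  grind

theorem hctCoeff₁_matching_hctCoeff₂ (w : Fin 12 → ℝ) (t : ℝ) :
    cubic (hctCoeff₁ w) t t = cubic (hctCoeff₂ w) t t ∧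
    cubicDerivU (hctCoeff₁ w) t t = cubicDerivU (hctCoeff₂ w) t t ∧
    cubicDerivV (hctCoeff₁ w) t t = cubicDerivV (hctCoeff₂ w) t t := by
  simp only [cubic, cubicDerivU, cubicDerivV, hctCoeff₁, hctCoeff₂, Matrix.cons_val]
  refine ⟨?_, ?_, ?_⟩ <;> ring

theorem hctCoeff₁_matching_hctCoeff₃ (w : Fin 12 → ℝ) (t : ℝ) :
    cubic (hctCoeff₁ w) 0 t = cubic (hctCoeff₃ w) 0 t ∧
    cubicDerivU (hctCoeff₁ w) 0 t = cubicDerivU (hctCoeff₃ w) 0 t ∧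
    cubicDerivV (hctCoeff₁ w) 0 t = cubicDerivV (hctCoeff₃ w) 0 t := by
  simp only [cubic, cubicDerivU, cubicDerivV, hctCoeff₁, hctCoeff₃, Matrix.cons_val]
  refine ⟨?_, ?_, ?_⟩ <;> ring

theorem hctCoeff₂_matching_hctCoeff₃ (w : Fin 12 → ℝ) (t : ℝ) :
    cubic (hctCoeff₂ w) t 0 = cubic (hctCoeff₃ w) t 0 ∧
    cubicDerivU (hctCoeff₂ w) t 0 = cubicDerivU (hctCoeff₃ w) t 0 ∧
    cubicDerivV (hctCoeff₂ w) t 0 = cubicDerivV (hctCoeff₃ w) t 0 := by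
  simp only [cubic, cubicDerivU, cubicDerivV, hctCoeff₂, hctCoeff₃, Matrix.cons_val]
  refine ⟨?_, ?_, ?_⟩ <;> ring

theorem hctCoeff_matching (w : Fin 12 → ℝ) {i j : Fin 3} {u v : ℝ}
    (hi : (u, v) ∈ hctSector i) (hj : (u, v) ∈ hctSector j) :
    cubic (hctCoeff i w) u v = cubic (hctCoeff j w) u v ∧
    cubicDerivU (hctCoeff i w) u v = cubicDerivU (hctCoeff j w) u v ∧
    cubicDerivV (hctCoeff i w) u v = cubicDerivV (hctCoeff j w) u v := by
  wlog hij : i < j generalizing i j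
  · rcases (not_lt.1 hij).eq_or_lt with rfl | h
    · exact ⟨rfl, rfl, rfl⟩
    · obtain ⟨h₁, h₂, h₃⟩ := this hj hi h
      exact ⟨h₁.symm, h₂.symm, h₃.symm⟩
  obtain ⟨rfl, rfl⟩ | ⟨rfl, rfl⟩ | ⟨rfl, rfl⟩ :
      i = 0 ∧ j = 1 ∨ i = 0 ∧ j = 2 ∨ i = 1 ∧ j = 2 := by lia
  · obtain rfl : u = v := le_antisymm hi.2 hj.2
    exact hctCoeff₁_matching_hctCoeff₂ w u
  · obtain rfl : u = 0 := le_antisymm hi.1 hj.1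
    exact hctCoeff₁_matching_hctCoeff₃ w v
  · obtain rfl : v = 0 := le_antisymm hi.1 hj.2
    exact hctCoeff₂_matching_hctCoeff₃ w u

/-- A function that agrees with `C¹` functions on the members of a finite closed cover is `C¹`
as soon as the derivatives match. -/
theorem contDiff_one_of_finite_closed_cover {ι E F : Type*} [Finite ι]
    [NormedAddCommGroup E] [NormedSpace ℝ E] [NormedAddCommGroup F] [NormedSpace ℝ F]
    {s : ι → Set E} (hs : ∀ i, IsClosed (s i)) (hcover : ⋃ i, s i = Set.univ)
    {f : E → F} {f' : E → E →L[ℝ] F} {g : ι → E → F} {g' : ι → E → E →L[ℝ] F}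
    (hg : ∀ i x, HasFDerivAt (g i) (g' i x) x) (hg' : ∀ i, Continuous (g' i))
    (hf : ∀ i, Set.EqOn f (g i) (s i)) (hf' : ∀ i, Set.EqOn f' (g' i) (s i)) :
    ContDiff ℝ 1 f := by
  rw [contDiff_one_iff_hasFDerivAt]
  refine ⟨f', ?_, fun x ↦ ?_⟩
  · exact (locallyFinite_of_finite s).continuous hcover hs
      fun i ↦ (hg' i).continuousOn.congr (hf' i)
  · rw [← hasFDerivWithinAt_univ, ← hcover]
    have h (i : ι) : HasFDerivWithinAt f (f' x) (s i) x := by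
      by_cases hx : x ∈ s i
      · rw [hf' i hx]
        exact (hg i x).hasFDerivWithinAt.congr (hf i) (hf i hx)
      · exact .of_notMem_closure (by rwa [(hs i).closure_eq])
    simp only [hasFDerivWithinAt_iff_isLittleO, nhdsWithin_iUnion, Asymptotics.isLittleO_iff,
      Filter.eventually_iSup] at h ⊢
    exact fun c hc i ↦ h i hc

theorem hasFDerivAt_cubic {E : Type*} [NormedAddCommGroup E] [NormedSpace ℝ E]
    (c : Fin 10 → ℝ) {u v : E → ℝ} {U V : E →L[ℝ] ℝ} {x : E}
    (hu : HasFDerivAt u U x) (hv : HasFDerivAt v V x) :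
    HasFDerivAt (fun y ↦ cubic c (u y) (v y))
      (cubicDerivU c (u x) (v x) • U + cubicDerivV c (u x) (v x) • V) x := by
  have h := ((((((((((hasFDerivAt_const (c 0) x).add (hu.const_mul (c 1))).add
    (hv.const_mul (c 2))).add ((hu.pow 2).const_mul (c 3))).add
    ((hu.mul hv).const_mul (c 4))).add ((hv.pow 2).const_mul (c 5))).add
    ((hu.pow 3).const_mul (c 6))).add (((hu.pow 2).mul hv).const_mul (c 7))).add
    ((hu.mul (hv.pow 2)).const_mul (c 8))).add ((hv.pow 3).const_mul (c 9)))
  refine h.congr_fderiv ?_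
  ext y
  simp [cubicDerivU, cubicDerivV]
  ring

theorem continuous_cubicDerivU (c : Fin 10 → ℝ) {X : Type*} [TopologicalSpace X] {u v : X → ℝ}
    (hu : Continuous u) (hv : Continuous v) : Continuous fun x ↦ cubicDerivU c (u x) (v x) := by
  unfold cubicDerivU
  fun_prop

theorem continuous_cubicDerivV (c : Fin 10 → ℝ) {X : Type*} [TopologicalSpace X] {u v : X → ℝ}
    (hu : Continuous u) (hv : Continuous v) : Continuous fun x ↦ cubicDerivV c (u x) (v x) := by
  unfold cubicDerivV
  fun_prop

namespace MvPolynomial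

theorem totalDegree_bind₁_le {σ τ R : Type*} [CommSemiring R] {f : σ → MvPolynomial τ R}
    (hf : ∀ i, (f i).totalDegree ≤ 1) (p : MvPolynomial σ R) :
    (bind₁ f p).totalDegree ≤ p.totalDegree := by
  rw [bind₁, aeval_def, eval₂_eq]
  refine totalDegree_finsetSum_le fun d hd ↦ ?_
  refine (totalDegree_mul _ _).trans ?_
  rw [algebraMap_eq, totalDegree_C, zero_add]
  refine (totalDegree_finsetProd _ _).trans ((Finset.sum_le_sum fun i _ ↦ ?_).trans
    (le_totalDegree hd))
  exact (totalDegree_pow _ _).trans (by simpa using Nat.mul_le_mul_left (d i) (hf i))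

theorem eval_bind₁ {σ τ R : Type*} [CommSemiring R] (s : τ → R) (f : σ → MvPolynomial τ R)
    (p : MvPolynomial σ R) : eval s (bind₁ f p) = eval (fun i ↦ eval s (f i)) p := by
  simp only [← coe_aeval_eq_eval, RingHom.coe_coe]
  exact aeval_bind₁ s f p

theorem exists_eval_eq_cubic {p : MvPolynomial (Fin 2) ℝ} (hp : p.totalDegree ≤ 3) :
    ∃ c : Fin 10 → ℝ, ∀ s : Fin 2 → ℝ, eval s p = cubic c (s 0) (s 1) := by
  rw [p.as_sum]
  refine Finset.sum_induction _
    (fun q ↦ ∃ c : Fin 10 → ℝ, ∀ s : Fin 2 → ℝ, eval s q = cubic c (s 0) (s 1)) ?_ ?_ ?_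
  · rintro q r ⟨c, hc⟩ ⟨d, hd⟩
    refine ⟨c + d, fun s ↦ ?_⟩
    simp only [map_add, hc, hd, cubic, Pi.add_apply]
    ring
  · exact ⟨0, fun s ↦ by simp [cubic]⟩
  · intro d hd
    have hdeg := (le_totalDegree hd).trans hp
    rw [Finsupp.sum_fintype _ _ fun _ ↦ rfl, Fin.sum_univ_two] at hdeg
    simp only [eval_monomial, Finsupp.prod_fintype _ _ fun _ ↦ pow_zero _, Fin.prod_univ_two]
    generalize coeff d p = a, d 0 = m, d 1 = n at hdeg
    have hm : m ≤ 3 := by lia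
    have hn : n ≤ 3 := by lia
    interval_cases m <;> interval_cases n <;> try lia
    exacts [⟨Pi.single 0 a, fun s ↦ by simp [cubic]⟩,
      ⟨Pi.single 2 a, fun s ↦ by simp [cubic]⟩,
      ⟨Pi.single 5 a, fun s ↦ by simp [cubic]⟩,
      ⟨Pi.single 9 a, fun s ↦ by simp [cubic]⟩,
      ⟨Pi.single 1 a, fun s ↦ by simp [cubic]⟩,
      ⟨Pi.single 4 a, fun s ↦ by simp [cubic]⟩,
      ⟨Pi.single 8 a, fun s ↦ by simp [cubic]⟩,
      ⟨Pi.single 3 a, fun s ↦ by simp [cubic]⟩,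
      ⟨Pi.single 7 a, fun s ↦ by simp [cubic]⟩,
      ⟨Pi.single 6 a, fun s ↦ by simp [cubic]⟩]

theorem exists_totalDegree_le_eval_eq_cubic (c : Fin 10 → ℝ) :
    ∃ p : MvPolynomial (Fin 2) ℝ, p.totalDegree ≤ 3 ∧
      ∀ s : Fin 2 → ℝ, eval s p = cubic c (s 0) (s 1) := by
  have h (a : ℝ) (i j : ℕ) (hij : i + j ≤ 3) :
      (C a * (X 0 ^ i * X 1 ^ j) : MvPolynomial (Fin 2) ℝ).totalDegree ≤ 3 := by
    refine (totalDegree_mul _ _).trans ?_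
    rw [totalDegree_C, zero_add]
    refine (totalDegree_mul _ _).trans ?_
    rwa [totalDegree_X_pow, totalDegree_X_pow]
  have hadd {p q : MvPolynomial (Fin 2) ℝ} (hp : p.totalDegree ≤ 3) (hq : q.totalDegree ≤ 3) :
      (p + q).totalDegree ≤ 3 := (totalDegree_add _ _).trans (max_le hp hq)
  refine ⟨_, hadd (hadd (hadd (hadd (hadd (hadd (hadd (hadd (hadd (h (c 0) 0 0 ?_)
    (h (c 1) 1 0 ?_)) (h (c 2) 0 1 ?_)) (h (c 3) 2 0 ?_)) (h (c 4) 1 1 ?_)) (h (c 5) 0 2 ?_))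
    (h (c 6) 3 0 ?_)) (h (c 7) 2 1 ?_)) (h (c 8) 1 2 ?_)) (h (c 9) 0 3 ?_), fun s ↦ ?_⟩
  all_goals simp [cubic]

end MvPolynomial

theorem mem_convexHull_triple {E : Type*} [AddCommGroup E] [Module ℝ E] {a b c x : E} :
    x ∈ convexHull ℝ {a, b, c} ↔
      ∃ r s t : ℝ, 0 ≤ r ∧ 0 ≤ s ∧ 0 ≤ t ∧ r + s + t = 1 ∧ r • a + s • b + t • c = x := by
  constructor
  · rw [convexHull_insert (by simp), convexHull_pair]
    simp only [convexJoin_singleton_left, Set.mem_iUnion, segment, Set.mem_ofPred_eq]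
    rintro ⟨y, ⟨p, q, hp, hq, hpq, rfl⟩, r, s, hr, hs, hrs, rfl⟩
    refine ⟨r, s * p, s * q, hr, by positivity, by positivity, ?_, by module⟩
    rw [add_assoc, ← mul_add, hpq, mul_one, hrs]
  · rintro ⟨r, s, t, hr, hs, ht, h, rfl⟩
    have := (convex_convexHull ℝ {a, b, c}).sum_mem (t := Finset.univ) (w := ![r, s, t])
      (z := ![a, b, c]) ?_ ?_ ?_
    · simpa [Fin.sum_univ_three] using this
    · intro i _
      fin_cases i <;> simpa
    · simpa [Fin.sum_univ_three] using h
    · intro i _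
      exact subset_convexHull ℝ _ (by fin_cases i <;> simp)

/-- `U` and `V` are the coordinate functionals of the basis `d`, `e`. -/
structure IsDualPair {E : Type*} [NormedAddCommGroup E] [NormedSpace ℝ E]
    (d e : E) (U V : E →L[ℝ] ℝ) : Prop where
  left_left : U d = 1
  left_right : U e = 0
  right_left : V d = 0
  right_right : V e = 1
  expand : ∀ y, U y • d + V y • e = y

namespace IsDualPair

variable {E : Type*} [NormedAddCommGroup E] [NormedSpace ℝ E] {d e : E} {U V : E →L[ℝ] ℝ}

/-- Rotating the triple `d`, `e`, `-(d + e)`. -/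
theorem rotate (h : IsDualPair d e U V) : IsDualPair e (-(d + e)) (V - U) (-U) where
  left_left := by simp [h.left_right, h.right_right]
  left_right := by simp [h.left_left, h.left_right, h.right_left, h.right_right]
  right_left := by simp [h.left_right]
  right_right := by simp [h.left_left, h.left_right]
  expand y := by
    conv_rhs => rw [← h.expand y]
    simp only [sub_apply, neg_apply]
    module

theorem mem_triangle_iff (h : IsDualPair d e U V) {G x : E} :
    x ∈ convexHull ℝ {G, G + d, G + e} ↔
      0 ≤ U (x - G) ∧ 0 ≤ V (x - G) ∧ U (x - G) + V (x - G) ≤ 1 := by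
  rw [mem_convexHull_triple]
  constructor
  · rintro ⟨r, s, t, hr, hs, ht, hsum, rfl⟩
    have hx : r • G + s • (G + d) + t • (G + e) - G = s • d + t • e := by
      obtain rfl : r = 1 - s - t := by linarith
      module
    simp only [hx, map_add, map_smul, h.left_left, h.left_right, h.right_left, h.right_right,
      smul_eq_mul]
    refine ⟨?_, ?_, ?_⟩ <;> linarith
  · rintro ⟨hU, hV, hUV⟩
    refine ⟨1 - U (x - G) - V (x - G), U (x - G), V (x - G), by linarith, hU, hV, by ring, ?_⟩
    calc _ = (U (x - G) • d + V (x - G) • e) + G := by module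
      _ = x := by rw [h.expand, sub_add_cancel]

theorem uniqueDiffOn_triangle (h : IsDualPair d e U V) (G : E) :
    UniqueDiffOn ℝ (convexHull ℝ {G, G + d, G + e}) := by
  refine uniqueDiffOn_convex (convex_convexHull ℝ _)
    ⟨G + (3 : ℝ)⁻¹ • (d + e), mem_interior.2 ⟨{x | 0 < U (x - G)} ∩ {x | 0 < V (x - G)} ∩
      {x | U (x - G) + V (x - G) < 1}, ?_, ?_, ?_⟩⟩
  · rintro x ⟨⟨hU, hV⟩, hUV⟩
    exact h.mem_triangle_iff.2 ⟨hU.le, hV.le, hUV.le⟩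
  · exact ((isOpen_lt (by fun_prop) (by fun_prop)).inter
      (isOpen_lt (by fun_prop) (by fun_prop))).inter (isOpen_lt (by fun_prop) (by fun_prop))
  · norm_num [h.left_left, h.left_right, h.right_left, h.right_right]

end IsDualPair

theorem exists_isDualPair_of_affineIndependent {a₁ a₂ a₃ G : EuclideanSpace ℝ (Fin 2)}
    (hind : AffineIndependent ℝ ![a₁, a₂, a₃]) (hG : G = (3 : ℝ)⁻¹ • (a₁ + a₂ + a₃)) :
    ∃ U V, IsDualPair (a₁ - G) (a₂ - G) U V := by
  have hli : LinearIndependent ℝ ![a₁ - G, a₂ - G] := by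
    rw [LinearIndependent.pair_iff]
    intro s t hst
    have h := affineIndependent_iff.1 hind Finset.univ
      ![s - (s + t) / 3, t - (s + t) / 3, -(s + t) / 3] (by simp [Fin.sum_univ_three]; ring) (by
        simp only [Fin.sum_univ_three, Matrix.cons_val]
        rw [← hst, hG]
        module)
    have h₁ := h 0 (Finset.mem_univ _)
    have h₂ := h 1 (Finset.mem_univ _)
    simp only [Matrix.cons_val] at h₁ h₂
    constructor <;> linarith
  let b := basisOfLinearIndependentOfCardEqFinrank hli (by simp)
  have hb₀ : b 0 = a₁ - G := by simp [b]
  have hb₁ : b 1 = a₂ - G := by simp [b]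
  refine ⟨(b.coord 0).toContinuousLinearMap, (b.coord 1).toContinuousLinearMap, ?_⟩
  rw [← hb₀, ← hb₁]
  exact
    { left_left := by simp
      left_right := by simp
      right_left := by simp
      right_right := by simp
      expand := fun y ↦ (Fin.sum_univ_two _).symm.trans (b.sum_repr y) }

theorem IsDualPair.agreesWithCubicOn_iff {d e : EuclideanSpace ℝ (Fin 2)}
    {U V : EuclideanSpace ℝ (Fin 2) →L[ℝ] ℝ} (h : IsDualPair d e U V)
    (G : EuclideanSpace ℝ (Fin 2)) {S : Set (EuclideanSpace ℝ (Fin 2))}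
    {f : EuclideanSpace ℝ (Fin 2) → ℝ} :
    AgreesWithCubicOn S f ↔
      ∃ c : Fin 10 → ℝ, ∀ x ∈ S, f x = cubic c (U (x - G)) (V (x - G)) := by
  open MvPolynomial in
  have hC (a : ℝ) (i : Fin 2) : (C a * X i : MvPolynomial (Fin 2) ℝ).totalDegree ≤ 1 :=
    (totalDegree_mul _ _).trans (by simp)
  have hlin (a b r : ℝ) :
      (C a * X 0 + C b * X 1 + C r : MvPolynomial (Fin 2) ℝ).totalDegree ≤ 1 :=
    (totalDegree_add _ _).trans (max_le ((totalDegree_add _ _).trans (max_le (hC _ _) (hC _ _)))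
      (by simp))
  constructor
  · rintro ⟨p, hp, hf⟩
    obtain ⟨c, hc⟩ := exists_eval_eq_cubic
      ((totalDegree_bind₁_le (fun i ↦ hlin (d i) (e i) (G i)) p).trans hp)
    refine ⟨c, fun x hx ↦ ?_⟩
    have := hc ![U (x - G), V (x - G)]
    simp only [Matrix.cons_val] at this
    rw [hf x hx, ← this, eval_bind₁]
    congr 2
    ext i
    have hi := congrArg (fun y : EuclideanSpace ℝ (Fin 2) ↦ y i) (h.expand (x - G))
    simp at hi ⊢
    linarith
  · rintro ⟨c, hc⟩
    obtain ⟨p, hp, hpc⟩ := exists_totalDegree_le_eval_eq_cubic c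
    have hcoord (W : EuclideanSpace ℝ (Fin 2) →L[ℝ] ℝ) (x : EuclideanSpace ℝ (Fin 2)) :
        W x = W (EuclideanSpace.single 0 1) * x 0 + W (EuclideanSpace.single 1 1) * x 1 := by
      conv_lhs => rw [show x = x 0 • EuclideanSpace.single 0 1 + x 1 • EuclideanSpace.single 1 1
        by ext i; fin_cases i <;> simp]
      simp [mul_comm]
    refine ⟨_, (totalDegree_bind₁_le (f := ![
      C (U (EuclideanSpace.single 0 1)) * X 0 + C (U (EuclideanSpace.single 1 1)) * X 1
        + C (-U G),
      C (V (EuclideanSpace.single 0 1)) * X 0 + C (V (EuclideanSpace.single 1 1)) * X 1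
        + C (-V G)]) (by intro i; fin_cases i <;> exact hlin _ _ _) p).trans hp, fun x hx ↦ ?_⟩
    rw [hc x hx, eval_bind₁, hpc, map_sub, map_sub, hcoord U x, hcoord V x]
    simp [sub_eq_add_neg]

theorem hctFun_eq_cubic (w : Fin 12 → ℝ) {i : Fin 3} {u v : ℝ} (h : (u, v) ∈ hctSector i) :
    hctFun w u v = cubic (hctCoeff i w) u v := by
  unfold hctFun
  split_ifs with h₁ h₂
  · exact (hctCoeff_matching w (i := 2) h₁ h).1
  · refine (hctCoeff_matching w (i := 0) ⟨?_, h₂⟩ h).1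
    by_contra! hu
    exact h₁ ⟨hu.le, hu.le.trans h₂⟩
  · refine (hctCoeff_matching w (i := 1) ⟨?_, (not_le.1 h₂).le⟩ h).1
    by_contra! hv
    exact h₁ ⟨(hv.trans (not_le.1 h₂)).le, hv.le⟩

theorem contDiff_hctFun {E : Type*} [NormedAddCommGroup E] [NormedSpace ℝ E]
    (w : Fin 12 → ℝ) (U V : E →L[ℝ] ℝ) (G : E) :
    ContDiff ℝ 1 fun x ↦ hctFun w (U (x - G)) (V (x - G)) := by
  have hcont : Continuous fun x ↦ (U (x - G), V (x - G)) := by fun_prop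
  choose k hk using fun x ↦ exists_mem_hctSector (U (x - G), V (x - G))
  refine contDiff_one_of_finite_closed_cover
    (s := fun i ↦ (fun x ↦ (U (x - G), V (x - G))) ⁻¹' hctSector i)
    (g := fun i x ↦ cubic (hctCoeff i w) (U (x - G)) (V (x - G)))
    (g' := fun i x ↦ cubicDerivU (hctCoeff i w) (U (x - G)) (V (x - G)) • U +
      cubicDerivV (hctCoeff i w) (U (x - G)) (V (x - G)) • V)
    (f' := fun x ↦ cubicDerivU (hctCoeff (k x) w) (U (x - G)) (V (x - G)) • U +
      cubicDerivV (hctCoeff (k x) w) (U (x - G)) (V (x - G)) • V)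
    (fun i ↦ (isClosed_hctSector i).preimage hcont)
    (Set.iUnion_eq_univ_iff.2 fun x ↦ ⟨k x, hk x⟩)
    (fun i x ↦ hasFDerivAt_cubic _ ?_ ?_) (fun i ↦ ?_) (fun i x hx ↦ hctFun_eq_cubic w hx)
    (fun i x hx ↦ ?_)
  · exact U.hasFDerivAt.comp x (hasFDerivAt_sub_const G)
  · exact V.hasFDerivAt.comp x (hasFDerivAt_sub_const G)
  · exact ((continuous_cubicDerivU _ (by fun_prop) (by fun_prop)).smul continuous_const).add
      ((continuous_cubicDerivV _ (by fun_prop) (by fun_prop)).smul continuous_const)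
  · obtain ⟨-, hU, hV⟩ := hctCoeff_matching w (hk x) hx
    simp only [hU, hV]

theorem IsDualPair.cubic_matching {E : Type*} [NormedAddCommGroup E] [NormedSpace ℝ E]
    {d e : E} {U V : E →L[ℝ] ℝ} (h : IsDualPair d e U V) {G x : E} {T S S' : Set E} {f : E → ℝ}
    {c c' : Fin 10 → ℝ} (hf : DifferentiableOn ℝ f T) (hST : S ⊆ T) (hST' : S' ⊆ T)
    (hS : UniqueDiffOn ℝ S) (hS' : UniqueDiffOn ℝ S') (hx : x ∈ S) (hx' : x ∈ S')
    (hc : ∀ y ∈ S, f y = cubic c (U (y - G)) (V (y - G)))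
    (hc' : ∀ y ∈ S', f y = cubic c' (U (y - G)) (V (y - G))) :
    cubic c (U (x - G)) (V (x - G)) = cubic c' (U (x - G)) (V (x - G)) ∧
    cubicDerivU c (U (x - G)) (V (x - G)) = cubicDerivU c' (U (x - G)) (V (x - G)) ∧
    cubicDerivV c (U (x - G)) (V (x - G)) = cubicDerivV c' (U (x - G)) (V (x - G)) := by
  have key {R : Set E} {b : Fin 10 → ℝ} (hRT : R ⊆ T) (hR : UniqueDiffOn ℝ R) (hxR : x ∈ R)
      (hb : ∀ y ∈ R, f y = cubic b (U (y - G)) (V (y - G))) :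
      fderivWithin ℝ f T x = cubicDerivU b (U (x - G)) (V (x - G)) • U +
        cubicDerivV b (U (x - G)) (V (x - G)) • V :=
    (hR x hxR).eq (((hf x (hRT hxR)).hasFDerivWithinAt).mono hRT)
      ((hasFDerivAt_cubic b (U.hasFDerivAt.comp x (hasFDerivAt_sub_const G))
        (V.hasFDerivAt.comp x (hasFDerivAt_sub_const G))).hasFDerivWithinAt.congr hb (hb x hxR))
  have heq := (key hST hS hx hc).symm.trans (key hST' hS' hx' hc')
  refine ⟨(hc x hx).symm.trans (hc' x hx'), ?_, ?_⟩
  · simpa [h.left_left, h.right_left] using congrArg (fun L : E →L[ℝ] ℝ ↦ L d) heq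
  · simpa [h.left_right, h.right_right] using congrArg (fun L : E →L[ℝ] ℝ ↦ L e) heq

/-- The triangle with vertices `(1, 0)`, `(0, 1)` and `(-1, -1)`. -/
def hctTriangle : Set (ℝ × ℝ) :=
  {p | p.1 + p.2 ≤ 1 ∧ p.2 - 2 * p.1 ≤ 1 ∧ p.1 - 2 * p.2 ≤ 1}

namespace IsDualPair

variable {E : Type*} [NormedAddCommGroup E] [NormedSpace ℝ E] {a₁ a₂ a₃ G : E} {U V : E →L[ℝ] ℝ}

theorem mem_subtriangle_iff (h : IsDualPair (a₁ - G) (a₂ - G) U V)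
    (hG : G = (3 : ℝ)⁻¹ • (a₁ + a₂ + a₃)) (i : Fin 3) (x : E) :
    x ∈ convexHull ℝ (![{G, a₂, a₃}, {G, a₃, a₁}, {G, a₁, a₂}] i) ↔
      (U (x - G), V (x - G)) ∈ hctTriangle ∩ hctSector i := by
  have e₃ : G + -((a₁ - G) + (a₂ - G)) = a₃ := by rw [hG]; module
  have e₁ : G + -((a₂ - G) + -((a₁ - G) + (a₂ - G))) = a₁ := by module
  have h₃ := h.mem_triangle_iff (G := G) (x := x)
  have h₁ := h.rotate.mem_triangle_iff (G := G) (x := x)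
  have h₂ := h.rotate.rotate.mem_triangle_iff (G := G) (x := x)
  simp only [e₁, e₃, add_sub_cancel] at h₁ h₂ h₃
  simp only [sub_apply, neg_apply] at h₁ h₂
  generalize U (x - G) = u at *
  generalize V (x - G) = v at *
  fin_cases i
  · refine h₁.trans (show _ ↔ (u + v ≤ 1 ∧ v - 2 * u ≤ 1 ∧ u - 2 * v ≤ 1) ∧ u ≤ 0 ∧ u ≤ v from
      ⟨fun ⟨_, _, _⟩ ↦ ⟨⟨?_, ?_, ?_⟩, ?_, ?_⟩, fun ⟨⟨_, _, _⟩, _, _⟩ ↦ ⟨?_, ?_, ?_⟩⟩) <;> linarith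
  · refine h₂.trans (show _ ↔ (u + v ≤ 1 ∧ v - 2 * u ≤ 1 ∧ u - 2 * v ≤ 1) ∧ v ≤ 0 ∧ v ≤ u from
      ⟨fun ⟨_, _, _⟩ ↦ ⟨⟨?_, ?_, ?_⟩, ?_, ?_⟩, fun ⟨⟨_, _, _⟩, _, _⟩ ↦ ⟨?_, ?_, ?_⟩⟩) <;> linarith
  · refine h₃.trans (show _ ↔ (u + v ≤ 1 ∧ v - 2 * u ≤ 1 ∧ u - 2 * v ≤ 1) ∧ 0 ≤ u ∧ 0 ≤ v from
      ⟨fun ⟨_, _, _⟩ ↦ ⟨⟨?_, ?_, ?_⟩, ?_, ?_⟩, fun ⟨⟨_, _, _⟩, _, _⟩ ↦ ⟨?_, ?_, ?_⟩⟩) <;> linarith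

theorem uniqueDiffOn_subtriangle (h : IsDualPair (a₁ - G) (a₂ - G) U V)
    (hG : G = (3 : ℝ)⁻¹ • (a₁ + a₂ + a₃)) (i : Fin 3) :
    UniqueDiffOn ℝ (convexHull ℝ (![{G, a₂, a₃}, {G, a₃, a₁}, {G, a₁, a₂}] i)) := by
  have e₃ : G + -((a₁ - G) + (a₂ - G)) = a₃ := by rw [hG]; module
  have e₁ : G + -((a₂ - G) + -((a₁ - G) + (a₂ - G))) = a₁ := by module
  have h₃ := h.uniqueDiffOn_triangle G
  have h₁ := h.rotate.uniqueDiffOn_triangle G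
  have h₂ := h.rotate.rotate.uniqueDiffOn_triangle G
  simp only [e₁, e₃, add_sub_cancel] at h₁ h₂ h₃
  fin_cases i
  exacts [h₁, h₂, h₃]

theorem mem_convexHull_iff (h : IsDualPair (a₁ - G) (a₂ - G) U V)
    (hG : G = (3 : ℝ)⁻¹ • (a₁ + a₂ + a₃)) (x : E) :
    x ∈ convexHull ℝ {a₁, a₂, a₃} ↔ (U (x - G), V (x - G)) ∈ hctTriangle := by
  constructor
  · rw [mem_convexHull_triple]
    rintro ⟨r, s, t, hr, hs, ht, hsum, rfl⟩
    have hx : r • a₁ + s • a₂ + t • a₃ - G = (r - t) • (a₁ - G) + (s - t) • (a₂ - G) := by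
      obtain rfl : r = 1 - s - t := by linarith
      rw [hG]
      module
    simp only [hctTriangle, Set.mem_ofPred_eq, hx, map_add, map_smul, h.left_left, h.left_right,
      h.right_left, h.right_right, smul_eq_mul]
    refine ⟨?_, ?_, ?_⟩ <;> linarith
  · intro hx
    obtain ⟨i, hi⟩ := exists_mem_hctSector (U (x - G), V (x - G))
    refine convexHull_min ?_ (convex_convexHull ℝ {a₁, a₂, a₃})
      ((h.mem_subtriangle_iff hG i x).2 ⟨hx, hi⟩)
    have hsub : ({a₁, a₂, a₃} : Set E) ⊆ convexHull ℝ {a₁, a₂, a₃} := subset_convexHull ℝ _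
    have hG_mem : G ∈ convexHull ℝ {a₁, a₂, a₃} :=
      mem_convexHull_triple.2 ⟨3⁻¹, 3⁻¹, 3⁻¹, by norm_num, by norm_num, by norm_num, by norm_num,
        by rw [hG]; module⟩
    simp only [Set.insert_subset_iff, Set.singleton_subset_iff] at hsub
    fin_cases i <;> simp [Set.insert_subset_iff, hG_mem, hsub]

end IsDualPair

/-- The HCT space has dimension 12: the space of functions on the triangle `T` that are `C¹`
on `T` and agree on each barycentric subtriangle `T₁, T₂, T₃` with a bivariate polynomial of
total degree at most 3 forms a real vector space (a submodule of `T → ℝ` under pointwise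
operations) of dimension exactly 12. -/
theorem hct_space_finrank_eq_twelve
    (a₁ a₂ a₃ G : EuclideanSpace ℝ (Fin 2)) (T T₁ T₂ T₃ : Set (EuclideanSpace ℝ (Fin 2)))
    (hind : AffineIndependent ℝ ![a₁, a₂, a₃])
    (hT : T = convexHull ℝ {a₁, a₂, a₃})
    (hG : G = (3 : ℝ)⁻¹ • (a₁ + a₂ + a₃))
    (hT₁ : T₁ = convexHull ℝ {G, a₂, a₃})
    (hT₂ : T₂ = convexHull ℝ {G, a₃, a₁})
    (hT₃ : T₃ = convexHull ℝ {G, a₁, a₂}) :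
    ∃ V : Submodule ℝ (T → ℝ),
      (∀ g : T → ℝ, g ∈ V ↔
        ∃ f : EuclideanSpace ℝ (Fin 2) → ℝ,
          (∀ x : T, g x = f x) ∧ ContDiffOn ℝ 1 f T ∧
          AgreesWithCubicOn T₁ f ∧ AgreesWithCubicOn T₂ f ∧ AgreesWithCubicOn T₃ f) ∧
      FiniteDimensional ℝ V ∧ Module.finrank ℝ V = 12 := by
  obtain ⟨U, V, h⟩ := exists_isDualPair_of_affineIndependent hind hG
  let S : Fin 3 → Set (EuclideanSpace ℝ (Fin 2)) :=
    fun i ↦ convexHull ℝ (![{G, a₂, a₃}, {G, a₃, a₁}, {G, a₁, a₂}] i)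
  have hS (i : Fin 3) (x) : x ∈ S i ↔ (U (x - G), V (x - G)) ∈ hctTriangle ∩ hctSector i :=
    h.mem_subtriangle_iff hG i x
  have hT_iff (x) : x ∈ T ↔ (U (x - G), V (x - G)) ∈ hctTriangle := by
    rw [hT]
    exact h.mem_convexHull_iff hG x
  have hagree (f : EuclideanSpace ℝ (Fin 2) → ℝ) :
      (AgreesWithCubicOn T₁ f ∧ AgreesWithCubicOn T₂ f ∧ AgreesWithCubicOn T₃ f) ↔
        ∀ i, AgreesWithCubicOn (S i) f := by
    subst hT₁ hT₂ hT₃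
    simp only [Fin.forall_fin_succ, S]
    simp
  have hST (i : Fin 3) : S i ⊆ T := fun x hx ↦ (hT_iff x).2 ((hS i x).1 hx).1
  have hpt (p q : ℝ) : ∃ x, U (x - G) = p ∧ V (x - G) = q :=
    ⟨G + (p • (a₁ - G) + q • (a₂ - G)), by
      rw [add_sub_cancel_left]
      simp only [map_add, map_smul, h.left_left, h.left_right, h.right_left, h.right_right]
      simp⟩
  let Φ : (Fin 12 → ℝ) →ₗ[ℝ] (T → ℝ) :=
    { toFun := fun w x ↦ hctFun w (U (x - G)) (V (x - G))
      map_add' := fun w w' ↦ funext fun x ↦ hctFun_add w w' _ _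
      map_smul' := fun r w ↦ funext fun x ↦ hctFun_smul r w _ _ }
  refine ⟨LinearMap.range Φ, fun g ↦ ?_, inferInstance, ?_⟩
  · simp only [hagree]
    simp only [h.agreesWithCubicOn_iff G]
    constructor
    · rintro ⟨w, rfl⟩
      exact ⟨fun x ↦ hctFun w (U (x - G)) (V (x - G)), fun x ↦ rfl,
        (contDiff_hctFun w U V G).contDiffOn,
        fun i ↦ ⟨hctCoeff i w, fun x hx ↦ hctFun_eq_cubic w ((hS i x).1 hx).2⟩⟩
    · rintro ⟨f, hgf, hf, hc⟩
      choose c hc using hc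
      have hmatch (i j : Fin 3) {p q : ℝ} (hi : (p, q) ∈ hctTriangle ∩ hctSector i)
          (hj : (p, q) ∈ hctSector j) :
          cubic (c i) p q = cubic (c j) p q ∧ cubicDerivU (c i) p q = cubicDerivU (c j) p q ∧
            cubicDerivV (c i) p q = cubicDerivV (c j) p q := by
        obtain ⟨x, rfl, rfl⟩ := hpt p q
        exact h.cubic_matching (hf.differentiableOn one_ne_zero) (hST i) (hST j)
          (h.uniqueDiffOn_subtriangle hG i) (h.uniqueDiffOn_subtriangle hG j)
          ((hS i x).2 hi) ((hS j x).2 ⟨hi.1, hj⟩) (hc i) (hc j)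
      obtain ⟨w, h₁, h₂, h₃⟩ := exists_hctCoeff_of_matching
        (c₁ := c 0) (c₂ := c 1) (c₃ := c 2)
        (fun t ⟨ht₀, ht₁⟩ ↦ by
          have := hmatch 2 1 (p := t) (q := 0)
            ⟨⟨by simpa, by linarith, by simpa⟩, ht₀, le_rfl⟩ ⟨le_rfl, ht₀⟩
          exact ⟨this.1, this.2.2⟩)
        (fun t ⟨ht₀, ht₁⟩ ↦ by
          have := hmatch 2 0 (p := 0) (q := t)
            ⟨⟨by simpa, by simpa, by linarith⟩, le_rfl, ht₀⟩ ⟨le_rfl, ht₀⟩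
          exact ⟨this.1, this.2.1⟩)
        (fun t ⟨ht₀, ht₁⟩ ↦ by
          have := hmatch 0 1 (p := -t) (q := -t)
            ⟨⟨by linarith, by linarith, by linarith⟩, neg_nonpos.2 ht₀, le_rfl⟩
            ⟨neg_nonpos.2 ht₀, le_rfl⟩
          exact ⟨this.1, this.2.1⟩)
      have hcw (i : Fin 3) : c i = hctCoeff i w := by
        fin_cases i
        exacts [h₁, h₂, h₃]
      refine ⟨w, funext fun x ↦ ?_⟩
      obtain ⟨i, hi⟩ := exists_mem_hctSector (U (x - G), V (x - G))
      rw [hgf x, hc i x ((hS i x).2 ⟨(hT_iff x).1 x.2, hi⟩), hcw]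
      exact hctFun_eq_cubic w hi
  · rw [LinearMap.finrank_range_of_inj, Module.finrank_fin_fun]
    rw [← LinearMap.ker_eq_bot, LinearMap.ker_eq_bot']
    intro w hw
    have hzero (i : Fin 3) {p q : ℝ} (hp : (p, q) ∈ hctTriangle) (hi : (p, q) ∈ hctSector i) :
        cubic (hctCoeff i w) p q = 0 := by
      obtain ⟨x, rfl, rfl⟩ := hpt p q
      rw [← hctFun_eq_cubic w hi]
      exact congrFun hw ⟨x, (hT_iff x).2 hp⟩
    exact eq_zero_of_hctCoeff_vanishing
      (fun u v hu hv huv ↦ hzero 2 ⟨huv, by linarith, by linarith⟩ ⟨hu, hv⟩)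
      (fun u v hu huv hv ↦ hzero 0 ⟨by linarith, hv, by linarith⟩ ⟨hu, huv⟩)
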